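/- Let δ₋, δ₊ > 0 and let g : [−δ₋, δ₊] → ℂ be continuously differentiable. Then the limit lim_{ε→0⁺} (1/2) ∫_{−δ₋}^{δ₊} g(r) (r − iε)^{−3/2} dr exists and equals −g(δ₊) δ₊^{−1/2} + i g(−δ₋) δ₋^{−1/2} + ∫_{−δ₋}^{δ₊} g′(r) w(r) dr, where w(r) := r^{−1/2} for r > 0 and w(r) := i |r|^{−1/2} for r < 0 (so that w is the pointwise limit of (r − iε)^{−1/2} as ε → 0⁺), and the last integral is an absolutely convergent improper integral. -/

import Mathlib

open MeasureTheory Filter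

/-- The boundary value `w(r)` of the principal branch of `(r − iε)^{−1/2}` as `ε → 0⁺`:
`w(r) = r^{−1/2}` for `r > 0` and `w(r) = i |r|^{−1/2}` for `r < 0`. -/
noncomputable def wBoundary (r : ℝ) : ℂ :=
  if 0 < r then ((r ^ (-(1 : ℝ) / 2) : ℝ) : ℂ)
  else Complex.I * ((|r| ^ (-(1 : ℝ) / 2) : ℝ) : ℂ)

/-- In the lower half-plane, `z ^ (-1/2) = i (-z) ^ (-1/2)` for the principal branch. -/
theorem Complex.cpow_neg_half_of_im_neg {z : ℂ} (hz : z.im < 0) :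
    z ^ (-(1 / 2) : ℂ) = Complex.I * (-z) ^ (-(1 / 2) : ℂ) := by
  have h0 : z ≠ 0 := by rintro rfl; simp at hz
  have hlog : Complex.log (-z) = Complex.log z + Real.pi * Complex.I := by
    simp only [Complex.log, norm_neg, Complex.arg_neg_eq_arg_add_pi_of_im_neg hz]
    push_cast
    ring
  rw [Complex.cpow_def_of_ne_zero h0, Complex.cpow_def_of_ne_zero (neg_ne_zero.mpr h0), hlog]
  have hI : Complex.exp (-(Real.pi / 2 * Complex.I)) = -Complex.I := by
    rw [Complex.exp_neg, Complex.exp_pi_div_two_mul_I, Complex.inv_I]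
  rw [show (Complex.log z + Real.pi * Complex.I) * (-(1 / 2)) =
    Complex.log z * (-(1 / 2)) + -(Real.pi / 2 * Complex.I) by ring, Complex.exp_add, hI]
  linear_combination (Complex.exp (Complex.log z * (-(1 / 2)))) * Complex.I_sq

theorem Complex.ofReal_sub_I_mul_mem_slitPlane (r : ℝ) {ε : ℝ} (hε : 0 < ε) :
    (r : ℂ) - Complex.I * (ε : ℂ) ∈ Complex.slitPlane :=
  Or.inr (by simp [hε.ne'])

theorem wBoundary_of_pos {r : ℝ} (hr : 0 < r) :
    wBoundary r = ((r ^ (-(1 : ℝ) / 2) : ℝ) : ℂ) := if_pos hr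

theorem wBoundary_of_nonpos {r : ℝ} (hr : r ≤ 0) :
    wBoundary r = Complex.I * ((|r| ^ (-(1 : ℝ) / 2) : ℝ) : ℂ) := if_neg hr.not_gt

theorem norm_wBoundary (r : ℝ) : ‖wBoundary r‖ = |r| ^ (-(1 : ℝ) / 2) := by
  have h : 0 ≤ |r| ^ (-(1 : ℝ) / 2) := by positivity
  rcases lt_or_ge 0 r with hr | hr
  · rw [wBoundary_of_pos hr, ← abs_of_pos hr, Complex.norm_real, Real.norm_of_nonneg (by simpa),
      abs_abs]
  · rw [wBoundary_of_nonpos hr, norm_mul, Complex.norm_I, one_mul, Complex.norm_real,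
      Real.norm_of_nonneg h]

theorem measurable_wBoundary : Measurable wBoundary := by
  refine Measurable.ite measurableSet_Ioi ?_ ?_
  · fun_prop
  · have : Measurable fun r : ℝ => |r| ^ (-(1 : ℝ) / 2) := measurable_norm.pow_const _
    fun_prop

/-- `wBoundary` is the boundary value of `z ^ (-1/2)` from the lower half-plane. -/
theorem tendsto_cpow_neg_half_wBoundary {r : ℝ} (hr : r ≠ 0) :
    Tendsto (fun ε : ℝ => ((r : ℂ) - Complex.I * (ε : ℂ)) ^ (-(1 / 2) : ℂ))
      (nhdsWithin 0 (Set.Ioi 0)) (nhds (wBoundary r)) := by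
  have key : ∀ {s c : ℝ}, 0 < s → Tendsto (fun ε : ℝ => ((s : ℂ) + c * Complex.I * (ε : ℂ)) ^
      (-(1 / 2) : ℂ)) (nhdsWithin 0 (Set.Ioi 0)) (nhds ((s ^ (-(1 : ℝ) / 2) : ℝ) : ℂ)) := by
    intro s c hs
    have hc : ContinuousAt (fun ε : ℝ => ((s : ℂ) + c * Complex.I * (ε : ℂ)) ^ (-(1 / 2) : ℂ)) 0 :=
      ContinuousAt.cpow (by fun_prop) continuousAt_const (Or.inl (by simpa using hs))
    have h := hc.tendsto.mono_left (nhdsWithin_le_nhds (s := Set.Ioi 0))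
    convert h using 2
    rw [Complex.ofReal_cpow hs.le]
    push_cast
    simp [neg_div]
  rcases hr.lt_or_gt with hr | hr
  · rw [wBoundary_of_nonpos hr.le]
    refine ((key (c := 1) (abs_pos.mpr hr.ne)).const_mul Complex.I).congr' ?_
    filter_upwards [self_mem_nhdsWithin] with ε hε
    rw [Complex.cpow_neg_half_of_im_neg (z := r - Complex.I * ε) (by simpa using hε),
      abs_of_neg hr]
    push_cast
    ring_nf
  · rw [wBoundary_of_pos hr]
    refine (key (c := -1) hr).congr fun ε => ?_
    push_cast
    ring_nf

theorem norm_cpow_neg_half_le {r : ℝ} (hr : r ≠ 0) (ε : ℝ) :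
    ‖((r : ℂ) - Complex.I * (ε : ℂ)) ^ (-(1 / 2) : ℂ)‖ ≤ |r| ^ (-(1 : ℝ) / 2) := by
  have h := Complex.norm_cpow_real ((r : ℂ) - Complex.I * (ε : ℂ)) (-(1 : ℝ) / 2)
  rw [show ((-(1 : ℝ) / 2 : ℝ) : ℂ) = -(1 / 2) by push_cast; ring] at h
  rw [h]
  refine Real.rpow_le_rpow_of_nonpos (abs_pos.mpr hr) ?_ (by norm_num)
  simpa using Complex.abs_re_le_norm ((r : ℂ) - Complex.I * (ε : ℂ))

theorem intervalIntegrable_abs_rpow {s : ℝ} (hs : -1 < s) (a b : ℝ) :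
    IntervalIntegrable (fun r : ℝ => |r| ^ s) volume a b := by
  have pos : ∀ {c : ℝ}, 0 ≤ c → IntervalIntegrable (fun r : ℝ => |r| ^ s) volume 0 c := by
    intro c hc
    refine (intervalIntegral.intervalIntegrable_rpow' hs).congr fun r hr => ?_
    rw [Set.uIoc_of_le hc] at hr
    simp only [abs_of_pos hr.1]
  have all : ∀ c : ℝ, IntervalIntegrable (fun r : ℝ => |r| ^ s) volume 0 c := by
    intro c
    rcases le_total 0 c with hc | hc
    · exact pos hc
    · rw [IntervalIntegrable.iff_comp_neg]
      simpa using pos (neg_nonneg.mpr hc)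
  exact (all a).symm.trans (all b)

theorem hasDerivAt_cpow_neg_half (r : ℝ) {ε : ℝ} (hε : 0 < ε) :
    HasDerivAt (fun r : ℝ => ((r : ℂ) - Complex.I * (ε : ℂ)) ^ (-(1 / 2) : ℂ))
      (-(1 / 2) * ((r : ℂ) - Complex.I * (ε : ℂ)) ^ (-(3 / 2) : ℂ)) r := by
  have h := ((hasDerivAt_id (r : ℂ)).sub_const (Complex.I * (ε : ℂ))).cpow_const
    (c := (-(1 / 2) : ℂ)) (Complex.ofReal_sub_I_mul_mem_slitPlane r hε)
  refine h.comp_ofReal.congr_deriv ?_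
  rw [id_eq, mul_one, show (-(1 / 2) - 1 : ℂ) = -(3 / 2) by norm_num]

/-- Integration by parts for the regularized integral. -/
theorem half_mul_integral_cpow_neg_three_half {a b ε : ℝ} (hab : a ≤ b) (hε : 0 < ε)
    {g g' : ℝ → ℂ}
    (hg : ∀ r ∈ Set.Icc a b, HasDerivWithinAt g (g' r) (Set.Icc a b) r)
    (hg' : ContinuousOn g' (Set.Icc a b)) :
    (1 / 2 : ℂ) * ∫ r in a..b, g r * ((r : ℂ) - Complex.I * (ε : ℂ)) ^ (-(3 / 2) : ℂ) =
      -(g b * ((b : ℂ) - Complex.I * (ε : ℂ)) ^ (-(1 / 2) : ℂ)) +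
        g a * ((a : ℂ) - Complex.I * (ε : ℂ)) ^ (-(1 / 2) : ℂ) +
        ∫ r in a..b, g' r * ((r : ℂ) - Complex.I * (ε : ℂ)) ^ (-(1 / 2) : ℂ) := by
  rw [← Set.uIcc_of_le hab] at hg hg'
  have hcont : Continuous fun r : ℝ =>
      -(1 / 2) * ((r : ℂ) - Complex.I * (ε : ℂ)) ^ (-(3 / 2) : ℂ) :=
    continuous_const.mul <| Continuous.cpow (by fun_prop) continuous_const
      fun r => Complex.ofReal_sub_I_mul_mem_slitPlane r hε
  have parts := intervalIntegral.integral_mul_deriv_eq_deriv_mul_of_hasDerivWithinAt hg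
    (fun r _ => (hasDerivAt_cpow_neg_half r hε).hasDerivWithinAt) hg'.intervalIntegrable
    (hcont.intervalIntegrable a b)
  simp_rw [mul_left_comm (g _)] at parts
  rw [intervalIntegral.integral_const_mul] at parts
  linear_combination -parts

/-- For `δ₋, δ₊ > 0` and `g` continuously differentiable on `[−δ₋, δ₊]` with derivative
`g'`, the integral `∫ g'(r) w(r) dr` converges absolutely, the limit
`lim_{ε→0⁺} (1/2) ∫_{−δ₋}^{δ₊} g(r) (r − iε)^{−3/2} dr` exists and equals
`−g(δ₊) δ₊^{−1/2} + i g(−δ₋) δ₋^{−1/2} + ∫_{−δ₋}^{δ₊} g'(r) w(r) dr`,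
where the complex powers are taken in the principal branch. -/
theorem principal_value_three_half_singularity
    (δm δp : ℝ) (hδm : 0 < δm) (hδp : 0 < δp)
    (g g' : ℝ → ℂ)
    (hg : ∀ r ∈ Set.Icc (-δm) δp, HasDerivWithinAt g (g' r) (Set.Icc (-δm) δp) r)
    (hg' : ContinuousOn g' (Set.Icc (-δm) δp)) :
    IntervalIntegrable (fun r => g' r * wBoundary r) volume (-δm) δp ∧
    Tendsto
      (fun ε : ℝ => (1 / 2 : ℂ) *
        ∫ r in (-δm)..δp, g r * ((r : ℂ) - Complex.I * (ε : ℂ)) ^ (-(3 / 2) : ℂ))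
      (nhdsWithin 0 (Set.Ioi 0))
      (nhds (-g δp * ((δp ^ (-(1 : ℝ) / 2) : ℝ) : ℂ) +
        Complex.I * g (-δm) * ((δm ^ (-(1 : ℝ) / 2) : ℝ) : ℂ) +
        ∫ r in (-δm)..δp, g' r * wBoundary r)) := by
  have hab : -δm ≤ δp := by linarith
  obtain ⟨C, hC⟩ := isCompact_Icc.exists_bound_of_continuousOn hg'
  have hsub : Set.uIoc (-δm) δp ⊆ Set.Icc (-δm) δp :=
    Set.uIoc_of_le hab ▸ Set.Ioc_subset_Icc_self
  have hmeas : AEStronglyMeasurable g' (volume.restrict (Set.uIoc (-δm) δp)) :=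
    (hg'.mono hsub).aestronglyMeasurable measurableSet_uIoc
  have hbound : IntervalIntegrable (fun r : ℝ => C * |r| ^ (-(1 : ℝ) / 2)) volume (-δm) δp :=
    (intervalIntegrable_abs_rpow (by norm_num) _ _).const_mul C
  constructor
  · refine hbound.mono_fun' (hmeas.mul measurable_wBoundary.aestronglyMeasurable) ?_
    refine (ae_restrict_iff' measurableSet_uIoc).mpr (.of_forall fun r hr => ?_)
    beta_reduce
    rw [norm_mul, norm_wBoundary]
    exact mul_le_mul_of_nonneg_right (hC r (hsub hr)) (by positivity)
  · have hint : Tendsto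
        (fun ε : ℝ => ∫ r in (-δm)..δp,
          g' r * ((r : ℂ) - Complex.I * (ε : ℂ)) ^ (-(1 / 2) : ℂ))
        (nhdsWithin 0 (Set.Ioi 0)) (nhds (∫ r in (-δm)..δp, g' r * wBoundary r)) := by
      have hne : ∀ᵐ r : ℝ, r ≠ 0 := Measure.ae_ne volume 0
      refine intervalIntegral.tendsto_integral_filter_of_dominated_convergence _
        (.of_forall fun ε => hmeas.mul ?_) (.of_forall fun ε => ?_) hbound ?_
      · exact Measurable.aestronglyMeasurable (by fun_prop)
      · filter_upwards [hne] with r hr hmem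
        rw [norm_mul]
        exact mul_le_mul (hC r (hsub hmem)) (norm_cpow_neg_half_le hr ε) (norm_nonneg _)
          ((norm_nonneg _).trans (hC r (hsub hmem)))
      · filter_upwards [hne] with r hr _
        exact (tendsto_cpow_neg_half_wBoundary hr).const_mul _
    have hlim := (((tendsto_cpow_neg_half_wBoundary hδp.ne').const_mul (g δp)).neg.add
      ((tendsto_cpow_neg_half_wBoundary (neg_ne_zero.mpr hδm.ne')).const_mul (g (-δm)))).add hint
    rw [wBoundary_of_pos hδp, wBoundary_of_nonpos (neg_nonpos.mpr hδm.le), abs_neg,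
      abs_of_pos hδm, ← neg_mul, mul_left_comm, ← mul_assoc Complex.I] at hlim
    refine hlim.congr' ?_
    filter_upwards [self_mem_nhdsWithin] with ε hε
    exact (half_mul_integral_cpow_neg_three_half hab hε hg hg').symm
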